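/- The fermionic Gaussian is invariant under the fermionic Fourier transform: F^±_{0|2n}(exp(x`²/2)) = exp(y`²/2), where exp(x`²/2) = Σ_{j=0}^n (x`²)^j/(2^j j!) with x`² = Σ_{j=1}^n x`_{2j−1} x`_{2j}, and likewise for the y` variables. -/

import Mathlib

open scoped BigOperators
open Finset MeasureTheory

noncomputable section

/-- The Grassmann algebra on `N` anticommuting generators with coefficients in a
commutative ring `R`, represented by its coefficients with respect to the basis of
increasingly-ordered monomials, indexed by subsets of the generators. -/
abbrev Gr (R : Type) (N : ℕ) : Type := Finset (Fin N) → R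

namespace Gr

variable {R : Type} [CommRing R] {N : ℕ}

/-- The sign produced when reordering the concatenation of the ordered monomials indexed
by `A` and `B` into the ordered monomial indexed by `A ∪ B`. -/
def msign (A B : Finset (Fin N)) : R :=
  (-1 : R) ^ (((A ×ˢ B).filter fun p => p.2 < p.1).card)

/-- Multiplication of the Grassmann algebra. -/
def mul (f g : Gr R N) : Gr R N :=
  fun s => ∑ A ∈ s.powerset, msign A (s \ A) * f A * g (s \ A)

/-- The unit of the Grassmann algebra. -/
def one : Gr R N := fun s => if s = (∅ : Finset (Fin N)) then 1 else 0

/-- The `j`-th generator of the Grassmann algebra. -/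
def gen (j : Fin N) : Gr R N := fun s => if s = {j} then 1 else 0

/-- Powers in the Grassmann algebra. -/
def pow (f : Gr R N) : ℕ → Gr R N
  | 0 => one
  | k + 1 => mul (pow f k) f

/-- The left partial derivative `∂_j`, i.e. the odd derivation with `∂_j(x_k) = δ_{jk}`. -/
def pderiv (j : Fin N) (f : Gr R N) : Gr R N :=
  fun s => if j ∈ s then 0
    else (-1 : R) ^ ((s.filter fun i => i < j).card) * f (insert j s)

/-- The exponential of a Grassmann algebra element with nilpotent (zero-constant-term)
argument: the series terminates, and all terms beyond degree `N` vanish. -/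
def gexp (f : Gr ℂ N) : Gr ℂ N :=
  ∑ k ∈ Finset.range (N + 1), ((k.factorial : ℂ))⁻¹ • pow f k

/-- Iterated left partial derivatives: the first element of the list acts first. -/
def derivList (l : List (Fin N)) (f : Gr R N) : Gr R N :=
  l.foldl (fun g j => pderiv j g) f

/-- Complex conjugation of the coefficients. -/
def gconj (f : Gr ℂ N) : Gr ℂ N := fun s => (starRingEnd ℂ) (f s)

end Gr

/-- The Lean index of the paper's generator `x`_{2j-1}` (j = 1,…,n). -/
def lo (n : ℕ) (j : Fin n) : Fin (2 * n) := ⟨2 * (j : ℕ), by have := j.isLt; omega⟩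

/-- The Lean index of the paper's generator `x`_{2j}` (j = 1,…,n). -/
def hi (n : ℕ) (j : Fin n) : Fin (2 * n) := ⟨2 * (j : ℕ) + 1, by have := j.isLt; omega⟩

/-- `x`² = Σ_{j=1}^n x`_{2j-1} x`_{2j}`. -/
def xsq (n : ℕ) : Gr ℂ (2 * n) := ∑ j : Fin n, Gr.mul (Gr.gen (lo n j)) (Gr.gen (hi n j))

/-- The fermionic Laplace operator `Δ_f = 4 Σ_{j=1}^n ∂_{x`_{2j-1}} ∂_{x`_{2j}}`. -/
def lapF (n : ℕ) (f : Gr ℂ (2 * n)) : Gr ℂ (2 * n) :=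
  (4 : ℂ) • ∑ j : Fin n, Gr.pderiv (lo n j) (Gr.pderiv (hi n j) f)

/-- The Berezin integral `∫_B = π^{-n} ∂_{x`_{2n}} ⋯ ∂_{x`_1}`. -/
def berezin (n : ℕ) (f : Gr ℂ (2 * n)) : ℂ :=
  ((Real.pi : ℂ) ^ n)⁻¹ * Gr.derivList (List.finRange (2 * n)) f ∅

/-- The fermionic Gaussian `exp(x`²/2) = Σ_{j=0}^n (x`²)^j/(2^j j!)`. -/
def fermGauss (n : ℕ) : Gr ℂ (2 * n) :=
  ∑ j ∈ Finset.range (n + 1), (((2 : ℂ) ^ j * j.factorial)⁻¹) • Gr.pow (xsq n) j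

/-- Embedding of the `x` generators into the Grassmann algebra on the `4n` generators
`x`_1, …, x`_{2n}, y`_1, …, y`_{2n}` (the `x` generators come first). -/
def xi (n : ℕ) (t : Fin (2 * n)) : Fin (2 * n + 2 * n) := Fin.castAdd (2 * n) t

/-- Embedding of the `y` generators into the Grassmann algebra on the `4n` generators. -/
def yi (n : ℕ) (t : Fin (2 * n)) : Fin (2 * n + 2 * n) := Fin.natAdd (2 * n) t

/-- The algebra embedding `Λ_{2n} → Λ_{4n}` sending the generators to the `x` generators. -/
def embX (n : ℕ) (f : Gr ℂ (2 * n)) : Gr ℂ (2 * n + 2 * n) :=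
  fun s => ∑ A : Finset (Fin (2 * n)), if s = A.image (xi n) then f A else 0

/-- The Berezin integral with respect to the `x` variables,
`π^{-n} ∂_{x`_{2n}} ⋯ ∂_{x`_1}`, inside the mixed algebra `Λ_{4n}`. -/
def berezinX (n : ℕ) (F : Gr ℂ (2 * n + 2 * n)) : Gr ℂ (2 * n + 2 * n) :=
  ((Real.pi : ℂ) ^ n)⁻¹ • Gr.derivList ((List.finRange (2 * n)).map (xi n)) F

/-- The fermionic Fourier kernel
`K^σ(x, y) = exp(-σ (i/2) Σ_{j=1}^n (x`_{2j-1} y`_{2j} - x`_{2j} y`_{2j-1}))`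
(for the plus sign `σ = 1`, for the minus sign `σ = -1`). -/
def fermK (n : ℕ) (σ : ℂ) : Gr ℂ (2 * n + 2 * n) :=
  Gr.gexp ((-σ * (Complex.I / 2)) • ∑ j : Fin n,
    (Gr.mul (Gr.gen (xi n (lo n j))) (Gr.gen (yi n (hi n j))) -
     Gr.mul (Gr.gen (xi n (hi n j))) (Gr.gen (yi n (lo n j)))))

/-- The fermionic Fourier transform
`F^σ_{0|2n}(g)(y) = (2π)^n ∫_{B,x} K^σ(x,y) g(x)`, an element of the Grassmann algebra
in the `y` variables, identified with `Λ_{2n}`. -/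
def fermFT (n : ℕ) (σ : ℂ) (g : Gr ℂ (2 * n)) : Gr ℂ (2 * n) :=
  fun s => (((2 * Real.pi : ℝ) : ℂ) ^ n) *
    berezinX n (Gr.mul (fermK n σ) (embX n g)) (s.image (yi n))


end

namespace Gr

variable {N : ℕ}

section Ring

variable {R : Type} [CommRing R]

lemma msign_union_left {A B C : Finset (Fin N)} (h : Disjoint A B) :
    (msign (A ∪ B) C : R) = msign A C * msign B C := by
  unfold msign
  rw [Finset.union_product, Finset.filter_union, Finset.card_union_of_disjoint, pow_add]
  refine Finset.disjoint_filter_filter ?_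
  rw [Finset.disjoint_left] at h ⊢
  intro p hp hq
  exact h (Finset.mem_product.1 hp).1 (Finset.mem_product.1 hq).1

lemma msign_union_right {A B C : Finset (Fin N)} (h : Disjoint B C) :
    (msign A (B ∪ C) : R) = msign A B * msign A C := by
  unfold msign
  rw [Finset.product_union, Finset.filter_union, Finset.card_union_of_disjoint, pow_add]
  refine Finset.disjoint_filter_filter ?_
  rw [Finset.disjoint_left] at h ⊢
  intro p hp hq
  exact h (Finset.mem_product.1 hp).2 (Finset.mem_product.1 hq).2

lemma mul_assoc' (f g h : Gr R N) : mul (mul f g) h = mul f (mul g h) := by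
  funext s
  simp only [mul, Finset.mul_sum, Finset.sum_mul]
  rw [Finset.sum_sigma', Finset.sum_sigma']
  refine Finset.sum_bij' (fun p _ => ⟨p.2, p.1 \ p.2⟩) (fun p _ => ⟨p.1 ∪ p.2, p.1⟩) ?_ ?_ ?_ ?_ ?_
  · rintro ⟨A, B⟩ hp
    simp only [Finset.mem_sigma, Finset.mem_powerset] at hp ⊢
    exact ⟨hp.2.trans hp.1, Finset.sdiff_subset_sdiff hp.1 le_rfl⟩
  · rintro ⟨B, C⟩ hp
    simp only [Finset.mem_sigma, Finset.mem_powerset] at hp ⊢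
    exact ⟨Finset.union_subset hp.1 (hp.2.trans Finset.sdiff_subset), Finset.subset_union_left⟩
  · rintro ⟨A, B⟩ hp
    simp only [Finset.mem_sigma, Finset.mem_powerset] at hp
    simp [Finset.union_sdiff_of_subset hp.2]
  · rintro ⟨B, C⟩ hp
    simp only [Finset.mem_sigma, Finset.mem_powerset] at hp
    have : Disjoint B C := (Finset.disjoint_of_subset_left hp.2 Finset.sdiff_disjoint).symm
    simp [Finset.union_sdiff_cancel_left this]
  · rintro ⟨A, B⟩ hp
    simp only [Finset.mem_sigma, Finset.mem_powerset] at hp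
    obtain ⟨hA, hB⟩ := hp
    have h1 : (s \ B) \ (A \ B) = s \ A := by
      ext x
      have := @hA x
      have := @hB x
      simp only [Finset.mem_sdiff]
      tauto
    have h2 : s \ B = (A \ B) ∪ (s \ A) := by
      ext x
      have := @hA x
      have := @hB x
      simp only [Finset.mem_sdiff, Finset.mem_union]
      tauto
    have h3 : Disjoint (A \ B) (s \ A) :=
      Finset.disjoint_of_subset_left Finset.sdiff_subset Finset.disjoint_sdiff
    have h4 : (msign A (s \ A) : R) = msign B (s \ A) * msign (A \ B) (s \ A) := by
      rw [← msign_union_left Finset.disjoint_sdiff, Finset.union_sdiff_of_subset hB]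
    simp only [h1]
    rw [h4, h2, msign_union_right h3]
    ring

lemma one_mul' (f : Gr R N) : mul one f = f := by
  funext s
  rw [mul, Finset.sum_eq_single ∅]
  · simp [one, msign]
  · intro A _ hA
    simp [one, hA]
  · simp

lemma mul_one' (f : Gr R N) : mul f one = f := by
  funext s
  rw [mul, Finset.sum_eq_single s]
  · simp [one, msign]
  · intro A hA hAs
    have : s \ A ≠ ∅ := fun h =>
      hAs (Finset.Subset.antisymm (Finset.mem_powerset.1 hA) (Finset.sdiff_eq_empty_iff_subset.1 h))
    simp [one, this]
  · simp

end Ring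

/-- The sign `(-1)^#{i ∈ s | i < j}` of moving the generator `j` past the smaller ones in `s`. -/
noncomputable def sg (j : Fin N) (s : Finset (Fin N)) : ℂ := (-1) ^ (s.filter fun i => i < j).card

lemma sg_mul_self (j : Fin N) (s : Finset (Fin N)) : sg j s * sg j s = 1 := by
  unfold sg
  rw [← pow_add, ← two_mul, pow_mul]
  simp

lemma sg_insert {i j : Fin N} {s : Finset (Fin N)} (h : j ∉ s) :
    sg i (insert j s) = (if j < i then -1 else 1) * sg i s := by
  unfold sg
  rw [Finset.filter_insert]
  split_ifs with hji
  · rw [Finset.card_insert_of_notMem (by simp [h]), pow_succ]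
    ring
  · ring

lemma sg_erase {i j : Fin N} {s : Finset (Fin N)} (h : j ∈ s) :
    sg i (s.erase j) = (if j < i then -1 else 1) * sg i s := by
  conv_rhs => rw [← Finset.insert_erase h, sg_insert (Finset.notMem_erase j s)]
  split_ifs <;> ring

/-- Left multiplication as a linear map into the endomorphisms. -/
noncomputable def mulL : Gr ℂ N →ₗ[ℂ] Module.End ℂ (Gr ℂ N) :=
  LinearMap.mk₂ ℂ mul
    (by intro f g h; funext s; simp only [mul, Pi.add_apply, ← Finset.sum_add_distrib]
        exact Finset.sum_congr rfl fun _ _ => by ring)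
    (by intro c f g; funext s; simp only [mul, Pi.smul_apply, smul_eq_mul, Finset.mul_sum]
        exact Finset.sum_congr rfl fun _ _ => by ring)
    (by intro f g h; funext s; simp only [mul, Pi.add_apply, ← Finset.sum_add_distrib]
        exact Finset.sum_congr rfl fun _ _ => by ring)
    (by intro c f g; funext s; simp only [mul, Pi.smul_apply, smul_eq_mul, Finset.mul_sum]
        exact Finset.sum_congr rfl fun _ _ => by ring)

lemma mulL_apply (f g : Gr ℂ N) : mulL f g = mul f g := rfl

lemma mulL_mul (f g : Gr ℂ N) : mulL (mul f g) = mulL f * mulL g :=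
  LinearMap.ext fun h => mul_assoc' f g h

lemma mulL_pow (f : Gr ℂ N) (k : ℕ) : mulL (pow f k) = mulL f ^ k := by
  induction k with
  | zero => exact LinearMap.ext fun h => one_mul' h
  | succ k ih => rw [pow, mulL_mul, ih, pow_succ]

/-- Left multiplication by a generator. -/
noncomputable def e (j : Fin N) : Module.End ℂ (Gr ℂ N) := mulL (gen j)

/-- The left partial derivative as a linear map. -/
noncomputable def d (j : Fin N) : Module.End ℂ (Gr ℂ N) where
  toFun := pderiv j
  map_add' f g := by
    funext s
    simp only [pderiv, Pi.add_apply]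
    split_ifs <;> ring
  map_smul' c f := by
    funext s
    simp only [pderiv, Pi.smul_apply, smul_eq_mul, RingHom.id_apply]
    split_ifs <;> ring

lemma d_apply (j : Fin N) (f : Gr ℂ N) (s : Finset (Fin N)) :
    d j f s = if j ∈ s then 0 else sg j s * f (insert j s) := rfl

lemma e_apply (j : Fin N) (f : Gr ℂ N) (s : Finset (Fin N)) :
    e j f s = if j ∈ s then sg j s * f (s.erase j) else 0 := by
  change mul (gen j) f s = _
  unfold mul
  split_ifs with h
  · rw [Finset.sum_eq_single {j}]
    · have h1 : s \ {j} = s.erase j := Finset.sdiff_singleton_eq_erase j s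
      have h2 : (msign {j} (s.erase j) : ℂ) = sg j (s.erase j) := by
        unfold msign sg
        congr 1
        refine Finset.card_bij (fun p _ => p.2) ?_ ?_ ?_
        · rintro ⟨a, b⟩ hp
          simp only [Finset.mem_filter, Finset.mem_product, Finset.mem_singleton] at hp ⊢
          exact ⟨hp.1.2, hp.1.1 ▸ hp.2⟩
        · rintro ⟨a, b⟩ hp ⟨a', b'⟩ hp' hb
          simp only [Finset.mem_filter, Finset.mem_product, Finset.mem_singleton] at hp hp' hb
          rw [hp.1.1, hp'.1.1, hb]
        · intro b hb
          simp only [Finset.mem_filter] at hb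
          exact ⟨(j, b), by simpa using hb, rfl⟩
      rw [h1, h2, sg_erase h]
      simp [gen]
    · intro A _ hA
      simp [gen, hA]
    · simp [h]
  · refine Finset.sum_eq_zero fun A hA => ?_
    have : A ≠ {j} := by
      rintro rfl
      exact h (by simpa using hA)
    simp [gen, this]

lemma e_mul_e (i j : Fin N) : e i * e j = -(e j * e i) := by
  refine LinearMap.ext fun f => funext fun s => ?_
  simp only [Module.End.mul_apply, LinearMap.neg_apply, Pi.neg_apply, e_apply]
  rcases eq_or_ne i j with rfl | hij
  · simp
  by_cases hi : i ∈ s <;> by_cases hj : j ∈ s <;> simp [hi, hj, hij, hij.symm]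
  rw [sg_erase hi, sg_erase hj, Finset.erase_right_comm]
  rcases lt_or_gt_of_ne hij with h | h <;> simp [h, h.not_gt] <;> ring

lemma d_mul_e (i j : Fin N) : d i * e j = (if i = j then 1 else 0) - e j * d i := by
  refine LinearMap.ext fun f => funext fun s => ?_
  rcases eq_or_ne i j with rfl | hij
  · simp only [Module.End.mul_apply, LinearMap.sub_apply, Pi.sub_apply, e_apply, d_apply, if_true,
      Module.End.one_apply]
    by_cases hi : i ∈ s
    · have := sg_mul_self i s
      simp [hi, sg_erase hi, ← mul_assoc, this]
    · have := sg_mul_self i s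
      simp [hi, sg_insert hi, ← mul_assoc, this]
  · simp only [Module.End.mul_apply, LinearMap.sub_apply, Pi.sub_apply, e_apply, d_apply,
      if_neg hij, LinearMap.zero_apply, Pi.zero_apply]
    by_cases hi : i ∈ s <;> by_cases hj : j ∈ s <;> simp [hi, hj, hij, hij.symm]
    rw [sg_erase hj, sg_insert hi, Finset.erase_insert_of_ne hij]
    rcases lt_or_gt_of_ne hij with h | h <;> simp [h, h.not_gt] <;> ring

lemma e_commute_pair (i a b : Fin N) : Commute (e i) (e a * e b) := by
  have h : ∀ (p q : Fin N) (f : Gr ℂ N), e p (e q f) = -e q (e p f) := fun p q f =>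
    congrArg (fun T : Module.End ℂ (Gr ℂ N) => T f) (e_mul_e p q)
  refine LinearMap.ext fun f => ?_
  simp only [Module.End.mul_apply]
  rw [h i a, h i b, map_neg, neg_neg]

lemma d_mul_pair (i a b : Fin N) : d i * (e a * e b) =
    e a * e b * d i + ((if i = a then e b else 0) - (if i = b then e a else 0)) := by
  rw [← mul_assoc, d_mul_e, sub_mul, mul_assoc, d_mul_e, mul_sub]
  split_ifs <;> simp [mul_assoc] <;> abel

/-- Truncated exponential series. -/
noncomputable def texp {A : Type*} [Ring A] [Algebra ℂ A] (M : ℕ) (Q : A) : A :=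
  ∑ k ∈ Finset.range (M + 1), ((k.factorial : ℂ))⁻¹ • Q ^ k

lemma mul_pow_of_commutator {A : Type*} [Ring A] {D Q c : A} (h : D * Q = Q * D + c)
    (hc : Commute c Q) (k : ℕ) : D * Q ^ (k + 1) = Q ^ (k + 1) * D + (k + 1 : ℕ) • (c * Q ^ k) := by
  induction k with
  | zero => simp [h]
  | succ k ih =>
    rw [pow_succ, ← mul_assoc, ih, add_mul, mul_assoc, h, smul_mul_assoc, mul_assoc c, ← pow_succ,
      mul_add, ← mul_assoc, ← (hc.pow_right (k + 1)).eq, add_assoc, succ_nsmul _ (k + 1)]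
    rw [add_comm (c * Q ^ (k + 1))]

lemma mul_texp {A : Type*} [Ring A] [Algebra ℂ A] {D Q c : A} (h : D * Q = Q * D + c)
    (hc : Commute c Q) {M : ℕ} (hM : c * Q ^ M = 0) :
    D * texp M Q = texp M Q * D + c * texp M Q := by
  have h1 : c * texp M Q = ∑ k ∈ Finset.range M, ((k.factorial : ℂ))⁻¹ • (c * Q ^ k) := by
    rw [texp, Finset.mul_sum, Finset.sum_range_succ]
    simp [hM]
  rw [h1, texp, Finset.sum_range_succ', mul_add, add_mul, Finset.mul_sum, Finset.sum_mul]
  have h2 : ∀ k ∈ Finset.range M, D * ((((k + 1).factorial : ℂ))⁻¹ • Q ^ (k + 1)) =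
      (((k + 1).factorial : ℂ))⁻¹ • Q ^ (k + 1) * D + ((k.factorial : ℂ))⁻¹ • (c * Q ^ k) := by
    intro k _
    rw [mul_smul_comm, mul_pow_of_commutator h hc, smul_add, smul_mul_assoc,
      ← Nat.cast_smul_eq_nsmul ℂ, smul_smul]
    congr 2
    rw [Nat.factorial_succ]
    push_cast
    have : ((k : ℂ) + 1) ≠ 0 := by exact_mod_cast Nat.succ_ne_zero k
    field_simp
  rw [Finset.sum_congr rfl h2, Finset.sum_add_distrib]
  simp
  abel

lemma commute_texp {A : Type*} [Ring A] [Algebra ℂ A] {c Q : A} (hc : Commute c Q) (M : ℕ) :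
    Commute c (texp M Q) :=
  Commute.sum_right _ _ _ fun k _ => (hc.pow_right k).smul_right _

section Quadratic

variable {ι : Type} [Fintype ι] (w : ι → ℂ) (a b : ι → Fin N)

/-- Multiplication by the quadratic element `∑ p, w p x_{a p} x_{b p}`. -/
noncomputable def quad : Module.End ℂ (Gr ℂ N) := ∑ p, w p • (e (a p) * e (b p))

/-- Multiplication by the derivative `∂_i` of `∑ p, w p x_{a p} x_{b p}`. -/
noncomputable def dquad (i : Fin N) : Module.End ℂ (Gr ℂ N) :=
  ∑ p, w p • ((if i = a p then e (b p) else 0) - (if i = b p then e (a p) else 0))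

lemma e_commute_quad (i : Fin N) : Commute (e i) (quad w a b) :=
  Commute.sum_right _ _ _ fun p _ => (e_commute_pair i (a p) (b p)).smul_right _

lemma dquad_commute_quad (i : Fin N) : Commute (dquad w a b i) (quad w a b) := by
  refine Commute.sum_left _ _ _ fun p _ => Commute.smul_left ?_ _
  refine Commute.sub_left ?_ ?_ <;> split_ifs <;>
    first | exact e_commute_quad w a b _ | exact Commute.zero_left _

lemma d_mul_quad (i : Fin N) : d i * quad w a b = quad w a b * d i + dquad w a b i := by
  simp only [quad, dquad, Finset.mul_sum, Finset.sum_mul, ← Finset.sum_add_distrib,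
    mul_smul_comm, smul_mul_assoc, d_mul_pair, smul_add]

/-- Vanishing of all components of degree less than `k`. -/
def degGE (k : ℕ) : Submodule ℂ (Gr ℂ N) where
  carrier := {f | ∀ s, s.card < k → f s = 0}
  add_mem' hf hg s hs := by simp [hf s hs, hg s hs]
  zero_mem' _ _ := rfl
  smul_mem' c f hf s hs := by simp [hf s hs]

lemma e_mem_degGE (i : Fin N) {k : ℕ} {f : Gr ℂ N} (hf : f ∈ degGE k) : e i f ∈ degGE (k + 1) := by
  intro s hs
  rw [e_apply]
  split_ifs with h
  · rw [hf, mul_zero]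
    have := Finset.card_erase_add_one h
    omega
  · rfl

lemma quad_pow_mem_degGE (k : ℕ) (f : Gr ℂ N) : (quad w a b ^ k) f ∈ degGE (2 * k) := by
  induction k with
  | zero => exact fun s hs => by simp at hs
  | succ k ih =>
    rw [pow_succ', Module.End.mul_apply, quad, LinearMap.sum_apply]
    refine Submodule.sum_mem _ fun p _ => ?_
    exact Submodule.smul_mem _ _ (e_mem_degGE _ (e_mem_degGE _ ih))

lemma dquad_mul_quad_pow (i : Fin N) {M : ℕ} (hM : N ≤ 2 * M) :
    dquad w a b i * quad w a b ^ M = 0 := by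
  refine LinearMap.ext fun f => ?_
  have h : (dquad w a b i * quad w a b ^ M) f ∈ degGE (2 * M + 1) := by
    rw [Module.End.mul_apply, dquad, LinearMap.sum_apply]
    refine Submodule.sum_mem _ fun p _ => Submodule.smul_mem _ _ (Submodule.sub_mem _ ?_ ?_) <;>
      split_ifs <;>
      first | exact e_mem_degGE _ (quad_pow_mem_degGE w a b M f) | exact Submodule.zero_mem _
  funext s
  refine h s ?_
  have := Finset.card_le_univ s
  rw [Fintype.card_fin] at this
  omega

lemma d_texp_quad (i : Fin N) {M : ℕ} (hM : N ≤ 2 * M) (f : Gr ℂ N) :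
    d i (texp M (quad w a b) f) =
      texp M (quad w a b) (d i f) + dquad w a b i (texp M (quad w a b) f) :=
  congrArg (fun T : Module.End ℂ (Gr ℂ N) => T f)
    (mul_texp (d_mul_quad w a b i) (dquad_commute_quad w a b i) (dquad_mul_quad_pow w a b i hM))

lemma texp_quad_e (i : Fin N) (M : ℕ) (f : Gr ℂ N) :
    texp M (quad w a b) (e i f) = e i (texp M (quad w a b) f) :=
  congrArg (fun T : Module.End ℂ (Gr ℂ N) => T f)
    (commute_texp (e_commute_quad w a b i) M).eq.symm

lemma texp_quad_empty (M : ℕ) (f : Gr ℂ N) : texp M (quad w a b) f ∅ = f ∅ := by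
  rw [texp, Finset.sum_range_succ', LinearMap.add_apply, LinearMap.sum_apply, Pi.add_apply,
    Finset.sum_apply, Finset.sum_eq_zero]
  · simp
  · intro k _
    rw [LinearMap.smul_apply, Pi.smul_apply,
      quad_pow_mem_degGE w a b (k + 1) f ∅ (by simp), smul_zero]

end Quadratic

/-- A solution of a system `∂_i f = w x_j f` is determined by its constant term. -/
lemma ext_of_d_eq {f g : Gr ℂ N}
    (h : ∀ i, ∃ (w : ℂ) (j : Fin N), d i f = w • e j f ∧ d i g = w • e j g)
    (h0 : f ∅ = g ∅) : f = g := by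
  funext s
  induction s using Finset.strongInduction with
  | H s ih =>
    rcases s.eq_empty_or_nonempty with rfl | ⟨i, hi⟩
    · exact h0
    obtain ⟨w, j, hf, hg⟩ := h i
    have key : ∀ u : Gr ℂ N, u s = sg i (s.erase i) * d i u (s.erase i) := by
      intro u
      rw [d_apply, if_neg (Finset.notMem_erase i s), Finset.insert_erase hi, ← mul_assoc,
        sg_mul_self, one_mul]
    rw [key f, key g, hf, hg, Pi.smul_apply, Pi.smul_apply, e_apply, e_apply]
    rw [ih ((s.erase i).erase j)
      ((Finset.erase_subset _ _).trans_ssubset (Finset.erase_ssubset hi))]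

lemma derivList_sorted (l : List (Fin N)) (hl : l.Pairwise (· < ·)) (f : Gr ℂ N)
    (s : Finset (Fin N)) (hs : ∀ i ∈ l, ∀ k ∈ s, i < k) :
    derivList l f s = f (l.toFinset ∪ s) := by
  induction l using List.reverseRecOn generalizing s with
  | nil => simp [derivList]
  | append_singleton l a ih =>
    rw [List.pairwise_append] at hl
    have ha : ∀ k ∈ s, a < k := hs a (by simp)
    have h1 : a ∉ s := fun h => lt_irrefl _ (ha a h)
    have h2 : s.filter (fun i => i < a) = ∅ :=
      Finset.filter_eq_empty_iff.2 fun k hk => (ha k hk).not_gt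
    have h3 : derivList (l ++ [a]) f s = pderiv a (derivList l f) s := by simp [derivList]
    rw [h3, pderiv, if_neg h1, h2, ih hl.1]
    · simp
    · intro i hi k hk
      rcases Finset.mem_insert.1 hk with rfl | hk
      · exact hl.2.2 i hi k (by simp)
      · exact hs i (by simp [hi]) k hk

/-- Pulling back coefficients along `s ↦ U ∪ φ(s)`. -/
def pull {m : ℕ} (φ : Fin m → Fin N) (U : Finset (Fin N)) : Gr ℂ N →ₗ[ℂ] Gr ℂ m where
  toFun F s := F (U ∪ s.image φ)
  map_add' _ _ := rfl
  map_smul' _ _ := rfl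

section Pull

variable {m : ℕ} {φ : Fin m → Fin N} {U : Finset (Fin N)}

lemma pull_apply (F : Gr ℂ N) (s : Finset (Fin m)) : pull φ U F s = F (U ∪ s.image φ) := rfl

lemma sg_union_image (hφ : StrictMono φ) {j : Fin m} (hU : Even (U.filter (· < φ j)).card)
    (hd : ∀ i, φ i ∉ U) (s : Finset (Fin m)) : sg (φ j) (U ∪ s.image φ) = sg j s := by
  unfold sg
  rw [Finset.filter_union, Finset.card_union_of_disjoint, pow_add, hU.neg_one_pow, one_mul,
    Finset.filter_image, Finset.card_image_of_injective _ hφ.injective]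
  · simp only [hφ.lt_iff_lt]
  · refine Finset.disjoint_filter_filter (Finset.disjoint_right.2 fun x hx => ?_)
    obtain ⟨i, _, rfl⟩ := Finset.mem_image.1 hx
    exact hd i

lemma mem_union_image (hφ : StrictMono φ) (hd : ∀ i, φ i ∉ U) (j : Fin m) (s : Finset (Fin m)) :
    φ j ∈ U ∪ s.image φ ↔ j ∈ s := by
  rw [Finset.mem_union, or_iff_right (hd j), hφ.injective.mem_finset_image]

lemma pull_d (hφ : StrictMono φ) (hU : ∀ j, Even (U.filter (· < φ j)).card)
    (hd : ∀ i, φ i ∉ U) (j : Fin m) (F : Gr ℂ N) : pull φ U (d (φ j) F) = d j (pull φ U F) := by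
  funext s
  simp only [pull_apply, d_apply, sg_union_image hφ (hU j) hd, mem_union_image hφ hd,
    Finset.image_insert, Finset.union_insert]

lemma pull_e (hφ : StrictMono φ) (hU : ∀ j, Even (U.filter (· < φ j)).card)
    (hd : ∀ i, φ i ∉ U) (j : Fin m) (F : Gr ℂ N) : pull φ U (e (φ j) F) = e j (pull φ U F) := by
  funext s
  simp only [pull_apply, e_apply, sg_union_image hφ (hU j) hd, mem_union_image hφ hd,
    Finset.image_erase hφ.injective, Finset.erase_union_distrib, Finset.erase_eq_of_notMem (hd j)]

lemma pull_d_eq_zero {i : Fin N} (hi : i ∈ U) (F : Gr ℂ N) : pull φ U (d i F) = 0 := by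
  funext s
  rw [pull_apply, d_apply, if_pos (Finset.mem_union_left _ hi)]
  rfl

lemma pull_e_eq_zero {i : Fin N} (hi : i ∉ U) (hφ : ∀ j, φ j ≠ i) (F : Gr ℂ N) :
    pull φ U (e i F) = 0 := by
  funext s
  rw [pull_apply, e_apply, if_neg]
  · rfl
  · simp [hi, hφ]

end Pull

end Gr

open Gr

section Indices

variable {n : ℕ}

lemma lo_inj {j k : Fin n} : lo n j = lo n k ↔ j = k := by
  simp only [lo, Fin.ext_iff]; omega

lemma hi_inj {j k : Fin n} : hi n j = hi n k ↔ j = k := by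
  simp only [hi, Fin.ext_iff]; omega

lemma lo_ne_hi (j k : Fin n) : lo n j ≠ hi n k := by
  simp only [lo, hi, ne_eq, Fin.ext_iff]; omega

lemma eq_lo_or_eq_hi (i : Fin (2 * n)) : ∃ j : Fin n, i = lo n j ∨ i = hi n j := by
  refine ⟨⟨i / 2, by omega⟩, ?_⟩
  simp only [lo, hi, Fin.ext_iff]
  omega

lemma xi_strictMono : StrictMono (xi n) := Fin.strictMono_castAdd _

lemma yi_strictMono : StrictMono (yi n) := Fin.strictMono_natAdd _

lemma xi_lt_yi (i j : Fin (2 * n)) : xi n i < yi n j := by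
  simp only [xi, yi, Fin.lt_def, Fin.val_castAdd, Fin.val_natAdd]; omega

lemma xi_inj {i j : Fin (2 * n)} : xi n i = xi n j ↔ i = j := xi_strictMono.injective.eq_iff

lemma yi_inj {i j : Fin (2 * n)} : yi n i = yi n j ↔ i = j := yi_strictMono.injective.eq_iff

lemma xi_ne_yi (i j : Fin (2 * n)) : xi n i ≠ yi n j := (xi_lt_yi i j).ne

end Indices

/-- The differential equations satisfied by multiples of the fermionic Gaussian. -/
structure IsGaussian {n : ℕ} (f : Gr ℂ (2 * n)) : Prop where
  d_lo : ∀ j, d (lo n j) f = (1 / 2 : ℂ) • e (hi n j) f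
  d_hi : ∀ j, d (hi n j) f = (-1 / 2 : ℂ) • e (lo n j) f

namespace IsGaussian

variable {n : ℕ} {f g : Gr ℂ (2 * n)}

lemma smul (hf : IsGaussian f) (c : ℂ) : IsGaussian (c • f) where
  d_lo j := by rw [map_smul, map_smul, hf.d_lo, smul_comm]
  d_hi j := by rw [map_smul, map_smul, hf.d_hi, smul_comm]

lemma ext_of_empty (hf : IsGaussian f) (hg : IsGaussian g) (h : f ∅ = g ∅) : f = g := by
  refine ext_of_d_eq (fun i => ?_) h
  obtain ⟨j, rfl | rfl⟩ := eq_lo_or_eq_hi i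
  · exact ⟨_, _, hf.d_lo j, hg.d_lo j⟩
  · exact ⟨_, _, hf.d_hi j, hg.d_hi j⟩

lemma insert_pair (hf : IsGaussian f) {j : Fin n} {s : Finset (Fin (2 * n))} (hl : lo n j ∉ s)
    (hh : hi n j ∉ s) : f (insert (lo n j) (insert (hi n j) s)) = 1 / 2 * f s := by
  have h1 : lo n j ∉ insert (hi n j) s := by simp [lo_ne_hi, hl]
  have h2 : sg (lo n j) (insert (hi n j) s) = sg (hi n j) (insert (hi n j) s) := by
    unfold sg
    congr 2
    refine Finset.filter_congr fun i hi' => ?_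
    have : i ≠ lo n j := fun h => h1 (h ▸ hi')
    simp only [lo, hi, Fin.lt_def, ne_eq, Fin.ext_iff] at this ⊢
    omega
  have h3 := congrFun (hf.d_lo j) (insert (hi n j) s)
  rw [Pi.smul_apply, d_apply, e_apply, if_neg h1, if_pos (Finset.mem_insert_self _ _), h2,
    Finset.erase_insert hh] at h3
  have h4 := congrArg (fun z => sg (hi n j) (insert (hi n j) s) * z) h3
  simp only [smul_eq_mul] at h4
  linear_combination h4 + (1 / 2 * f s - f (insert (lo n j) (insert (hi n j) s))) *
    sg_mul_self (hi n j) (insert (hi n j) s)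

lemma apply_univ (hf : IsGaussian f) : f Finset.univ = (1 / 2) ^ n * f ∅ := by
  have key : ∀ t : Finset (Fin n), f (t.biUnion fun j => {lo n j, hi n j}) =
      (1 / 2) ^ t.card * f ∅ := by
    intro t
    induction t using Finset.induction_on with
    | empty => simp
    | insert j t hj ih =>
      rw [Finset.biUnion_insert, Finset.card_insert_of_notMem hj, Finset.insert_union,
        Finset.singleton_union, hf.insert_pair, ih]
      · ring
      · simp only [Finset.mem_biUnion, not_exists, not_and, Finset.mem_insert,
          Finset.mem_singleton, lo_inj, lo_ne_hi, or_false]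
        rintro k hk rfl
        exact hj hk
      · simp only [Finset.mem_biUnion, not_exists, not_and, Finset.mem_insert,
          Finset.mem_singleton, hi_inj, (lo_ne_hi _ _).symm, false_or]
        rintro k hk rfl
        exact hj hk
  have h := key Finset.univ
  rw [Finset.card_univ, Fintype.card_fin] at h
  rw [← h]
  congr 1
  refine (Finset.eq_univ_iff_forall.2 fun i => ?_).symm
  obtain ⟨j, hj⟩ := eq_lo_or_eq_hi i
  simp only [Finset.mem_biUnion, Finset.mem_insert, Finset.mem_singleton]
  exact ⟨j, Finset.mem_univ _, hj⟩

end IsGaussian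

section Gauss

variable (n : ℕ)

lemma fermGauss_eq_texp :
    fermGauss n = texp n (quad (fun _ : Fin n => (1 / 2 : ℂ)) (lo n) (hi n)) Gr.one := by
  have h1 : quad (fun _ : Fin n => (1 / 2 : ℂ)) (lo n) (hi n) = (1 / 2 : ℂ) • mulL (xsq n) := by
    rw [quad, ← Finset.smul_sum, xsq, map_sum]
    simp only [mulL_mul, e]
  have h2 : ∀ j, Gr.pow (xsq n) j = (mulL (xsq n) ^ j) Gr.one := by
    intro j
    rw [← mulL_pow, mulL_apply, mul_one']
  rw [fermGauss, texp, LinearMap.sum_apply]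
  refine Finset.sum_congr rfl fun j _ => ?_
  rw [h1, h2, smul_pow, smul_smul, LinearMap.smul_apply]
  congr 1
  rw [mul_inv, one_div, inv_pow, mul_comm]

lemma isGaussian_fermGauss : IsGaussian (fermGauss n) := by
  have h0 : ∀ i : Fin (2 * n), d i (Gr.one : Gr ℂ (2 * n)) = 0 := by
    intro i
    funext s
    rw [d_apply]
    simp [Gr.one]
  rw [fermGauss_eq_texp]
  constructor <;> intro j
  · rw [d_texp_quad _ _ _ _ le_rfl, h0, map_zero, zero_add]
    simp [dquad, lo_inj, lo_ne_hi, Finset.sum_ite_eq]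
  · rw [d_texp_quad _ _ _ _ le_rfl, h0, map_zero, zero_add]
    simp [dquad, hi_inj, (lo_ne_hi _ _).symm, neg_div]

lemma fermGauss_empty : fermGauss n ∅ = 1 := by
  rw [fermGauss_eq_texp, texp_quad_empty, Gr.one, if_pos rfl]

variable {n}

lemma embX_image (f : Gr ℂ (2 * n)) (A : Finset (Fin (2 * n))) :
    embX n f (A.image (xi n)) = f A := by
  rw [embX, Finset.sum_eq_single A]
  · simp
  · intro B _ hB
    rw [if_neg]
    exact fun h => hB (Finset.image_injective xi_strictMono.injective h).symm
  · simp

lemma embX_of_ne (f : Gr ℂ (2 * n)) {s : Finset (Fin (2 * n + 2 * n))}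
    (h : ∀ A : Finset (Fin (2 * n)), s ≠ A.image (xi n)) : embX n f s = 0 :=
  Finset.sum_eq_zero fun A _ => if_neg (h A)

lemma pull_embX (f : Gr ℂ (2 * n)) : pull (xi n) ∅ (embX n f) = f := by
  funext s
  rw [pull_apply, Finset.empty_union, embX_image]

lemma embX_pull {F : Gr ℂ (2 * n + 2 * n)}
    (h : ∀ s, (∀ A : Finset (Fin (2 * n)), s ≠ A.image (xi n)) → F s = 0) :
    embX n (pull (xi n) ∅ F) = F := by
  funext s
  by_cases hs : ∃ A : Finset (Fin (2 * n)), s = A.image (xi n)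
  · obtain ⟨A, rfl⟩ := hs
    rw [embX_image, pull_apply, Finset.empty_union]
  · push Not at hs
    rw [embX_of_ne _ hs, h s hs]

lemma d_embX (j : Fin (2 * n)) (f : Gr ℂ (2 * n)) :
    d (xi n j) (embX n f) = embX n (d j f) := by
  rw [← embX_pull (F := d (xi n j) (embX n f)), pull_d xi_strictMono (by simp) (by simp),
    pull_embX]
  intro s hs
  rw [d_apply]
  split_ifs with h
  · rfl
  rw [embX_of_ne, mul_zero]
  intro A hA
  refine hs (A.erase j) ?_
  rw [Finset.image_erase xi_strictMono.injective, ← hA, Finset.erase_insert h]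

lemma e_embX (j : Fin (2 * n)) (f : Gr ℂ (2 * n)) :
    e (xi n j) (embX n f) = embX n (e j f) := by
  rw [← embX_pull (F := e (xi n j) (embX n f)), pull_e xi_strictMono (by simp) (by simp),
    pull_embX]
  intro s hs
  rw [e_apply]
  split_ifs with h
  · rw [embX_of_ne, mul_zero]
    intro A hA
    refine hs (insert j A) ?_
    rw [Finset.image_insert, ← hA, Finset.insert_erase h]
  · rfl

lemma d_yi_embX (j : Fin (2 * n)) (f : Gr ℂ (2 * n)) : d (yi n j) (embX n f) = 0 := by
  funext s
  rw [d_apply]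
  split_ifs with h
  · rfl
  rw [embX_of_ne, mul_zero, Pi.zero_apply]
  intro A hA
  have : yi n j ∈ A.image (xi n) := hA ▸ Finset.mem_insert_self _ _
  obtain ⟨i, _, hi⟩ := Finset.mem_image.1 this
  exact xi_ne_yi i j hi

lemma embX_smul (c : ℂ) (f : Gr ℂ (2 * n)) : embX n (c • f) = c • embX n f := by
  funext s
  simp only [embX, Pi.smul_apply, smul_eq_mul, Finset.mul_sum, mul_ite, mul_zero]

end Gauss

section Kernel

variable (n : ℕ) (c : ℂ)

/-- Multiplication by the exponent `c ∑ (x_{2j-1} y_{2j} - x_{2j} y_{2j-1})`. -/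
noncomputable def kernelQuad : Module.End ℂ (Gr ℂ (2 * n + 2 * n)) :=
  quad (Sum.elim (fun _ : Fin n => c) (fun _ : Fin n => -c))
    (Sum.elim (fun j => xi n (lo n j)) (fun j => xi n (hi n j)))
    (Sum.elim (fun j => yi n (hi n j)) (fun j => yi n (lo n j)))

lemma mulL_fermK (σ : ℂ) :
    mulL (fermK n σ) = texp (2 * n + 2 * n) (kernelQuad n (-σ * (Complex.I / 2))) := by
  have h : ∀ E : Gr ℂ (2 * n + 2 * n), mulL (gexp E) = texp (2 * n + 2 * n) (mulL E) := by
    intro E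
    rw [gexp, map_sum, texp]
    simp only [map_smul, mulL_pow]
  rw [fermK, h, kernelQuad, quad, Fintype.sum_sum_type]
  congr 1
  simp only [map_smul, map_sum, map_sub, mulL_mul, Sum.elim_inl, Sum.elim_inr,
    Finset.sum_sub_distrib, smul_sub, Finset.smul_sum, e]
  rw [sub_eq_add_neg, ← Finset.sum_neg_distrib]
  exact congrArg _ (Finset.sum_congr rfl fun j _ => (neg_smul _ _).symm)

variable {n} (g : Gr ℂ (2 * n))

/-- The integrand `exp(c ∑ (x_{2j-1} y_{2j} - x_{2j} y_{2j-1})) g(x)`. -/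
noncomputable def integrand : Gr ℂ (2 * n + 2 * n) :=
  texp (2 * n + 2 * n) (kernelQuad n c) (embX n g)

lemma integrand_empty : integrand c g ∅ = g ∅ := by
  rw [integrand, kernelQuad, texp_quad_empty, ← Finset.image_empty (xi n), embX_image]

lemma d_integrand_ylo (j : Fin n) :
    d (yi n (lo n j)) (integrand c g) = c • e (xi n (hi n j)) (integrand c g) := by
  rw [integrand, kernelQuad, d_texp_quad _ _ _ _ (by omega), d_yi_embX, map_zero, zero_add]
  simp [dquad, yi_inj, lo_inj, lo_ne_hi, (xi_ne_yi _ _).symm]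

lemma d_integrand_yhi (j : Fin n) :
    d (yi n (hi n j)) (integrand c g) = -c • e (xi n (lo n j)) (integrand c g) := by
  rw [integrand, kernelQuad, d_texp_quad _ _ _ _ (by omega), d_yi_embX, map_zero, zero_add]
  simp [dquad, yi_inj, hi_inj, (lo_ne_hi _ _).symm, (xi_ne_yi _ _).symm]

variable {g}

lemma d_integrand_xlo (hg : IsGaussian g) (j : Fin n) :
    d (xi n (lo n j)) (integrand c g) =
    (1 / 2 : ℂ) • e (xi n (hi n j)) (integrand c g) + c • e (yi n (hi n j)) (integrand c g) := by
  rw [integrand, kernelQuad, d_texp_quad _ _ _ _ (by omega), d_embX, hg.d_lo, embX_smul, map_smul,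
    ← e_embX, texp_quad_e]
  simp [dquad, xi_inj, lo_inj, lo_ne_hi, xi_ne_yi]

lemma d_integrand_xhi (hg : IsGaussian g) (j : Fin n) :
    d (xi n (hi n j)) (integrand c g) =
    (-1 / 2 : ℂ) • e (xi n (lo n j)) (integrand c g) + -c • e (yi n (lo n j)) (integrand c g) := by
  rw [integrand, kernelQuad, d_texp_quad _ _ _ _ (by omega), d_embX, hg.d_hi, embX_smul, map_smul,
    ← e_embX, texp_quad_e]
  simp [dquad, xi_inj, hi_inj, (lo_ne_hi _ _).symm, xi_ne_yi]

lemma isGaussian_pull_xi (hg : IsGaussian g) :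
    IsGaussian (pull (xi n) ∅ (integrand c g)) := by
  have h : ∀ i, pull (xi n) ∅ (e (yi n i) (integrand c g)) = 0 := fun i =>
    pull_e_eq_zero (by simp) (fun j => xi_ne_yi j i) _
  constructor <;> intro j
  · rw [← pull_d xi_strictMono (by simp) (by simp), d_integrand_xlo c hg, map_add, map_smul,
      map_smul, h, pull_e xi_strictMono (by simp) (by simp), smul_zero, add_zero]
  · rw [← pull_d xi_strictMono (by simp) (by simp), d_integrand_xhi c hg, map_add, map_smul,
      map_smul, h, pull_e xi_strictMono (by simp) (by simp), smul_zero, add_zero]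

lemma integrand_apply_top (hg : IsGaussian g) :
    integrand c g (Finset.univ.image (xi n)) = (1 / 2) ^ n * g ∅ := by
  have h := (isGaussian_pull_xi c hg).apply_univ
  rwa [pull_apply, pull_apply, Finset.empty_union, Finset.image_empty, Finset.empty_union,
    integrand_empty] at h

lemma isGaussian_pull_yi (hg : IsGaussian g) (hc : c * c = -1 / 4) :
    IsGaussian (pull (yi n) (Finset.univ.image (xi n)) (integrand c g)) := by
  have hd : ∀ i, yi n i ∉ Finset.univ.image (xi n) := by
    intro i
    simp [xi_ne_yi]
  have hU : ∀ j, Even ((Finset.univ.image (xi n)).filter (· < yi n j)).card := by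
    intro j
    rw [Finset.filter_true_of_mem, Finset.card_image_of_injective _ xi_strictMono.injective]
    · simp
    · intro x hx
      obtain ⟨i, _, rfl⟩ := Finset.mem_image.1 hx
      exact xi_lt_yi i j
  have hx : ∀ i, pull (yi n) (Finset.univ.image (xi n)) (d (xi n i) (integrand c g)) = 0 :=
    fun i => pull_d_eq_zero (by simp) _
  constructor <;> intro j
  · have h := hx (lo n j)
    rw [d_integrand_xlo c hg, map_add, map_smul, map_smul, pull_e yi_strictMono hU hd] at h
    rw [← pull_d yi_strictMono hU hd, d_integrand_ylo, map_smul]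
    funext s
    have hs := congrFun h s
    simp only [Pi.add_apply, Pi.smul_apply, smul_eq_mul, Pi.zero_apply] at hs ⊢
    linear_combination 2 * c * hs -
      2 * e (hi n j) (pull (yi n) (Finset.univ.image (xi n)) (integrand c g)) s * hc
  · have h := hx (hi n j)
    rw [d_integrand_xhi c hg, map_add, map_smul, map_smul, pull_e yi_strictMono hU hd] at h
    rw [← pull_d yi_strictMono hU hd, d_integrand_yhi, map_smul]
    funext s
    have hs := congrFun h s
    simp only [Pi.add_apply, Pi.smul_apply, smul_eq_mul, Pi.zero_apply] at hs ⊢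
    linear_combination 2 * c * hs +
      2 * e (lo n j) (pull (yi n) (Finset.univ.image (xi n)) (integrand c g)) s * hc

end Kernel

lemma berezinX_apply (n : ℕ) (F : Gr ℂ (2 * n + 2 * n)) (s : Finset (Fin (2 * n))) :
    berezinX n F (s.image (yi n)) =
      ((Real.pi : ℂ) ^ n)⁻¹ * pull (yi n) (Finset.univ.image (xi n)) F s := by
  rw [berezinX, Pi.smul_apply, smul_eq_mul, derivList_sorted, pull_apply]
  · congr 3
  · exact (List.pairwise_lt_finRange _).map _ fun _ _ h => xi_strictMono h
  · intro i hi k hk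
    obtain ⟨a, _, rfl⟩ := List.mem_map.1 hi
    obtain ⟨b, _, rfl⟩ := Finset.mem_image.1 hk
    exact xi_lt_yi a b

/-- The fermionic Gaussian `exp(x`²/2) = Σ_{j=0}^n (x`²)^j/(2^j j!)` is invariant under
the fermionic Fourier transform: `F^±_{0|2n}(exp(x`²/2)) = exp(y`²/2)`. -/
theorem fermFT_gauss (n : ℕ) (σ : ℂ) (hσ : σ = 1 ∨ σ = -1) :
    fermFT n σ (fermGauss n) = fermGauss n := by
  set c : ℂ := -σ * (Complex.I / 2) with hc_def
  have hc : c * c = -1 / 4 := by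
    have hσ2 : σ * σ = 1 := by rcases hσ with rfl | rfl <;> norm_num
    linear_combination (-1 / 4 : ℂ) * hσ2 + σ * σ / 4 * Complex.I_mul_I
  have hg := isGaussian_fermGauss n
  have h : fermFT n σ (fermGauss n) =
      (2 : ℂ) ^ n • pull (yi n) (Finset.univ.image (xi n)) (integrand c (fermGauss n)) := by
    funext s
    rw [fermFT, berezinX_apply, ← mulL_apply, mulL_fermK, Pi.smul_apply, smul_eq_mul, ← mul_assoc]
    congr 1
    have : (Real.pi : ℂ) ≠ 0 := by exact_mod_cast Real.pi_ne_zero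
    push_cast
    rw [mul_pow]
    field_simp
  rw [h]
  refine ((isGaussian_pull_yi c hg hc).smul _).ext_of_empty hg ?_
  rw [Pi.smul_apply, pull_apply, Finset.image_empty, Finset.union_empty,
    integrand_apply_top c hg, fermGauss_empty, smul_eq_mul, mul_one, ← mul_pow]
  norm_num
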